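/- Let μ and μ̃ be Borel probability measures on ℝ supported on a compact interval, with μ satisfying the basic assumptions, and let k ≥ 1. Let ṽ ∈ (0,1)ᵏ be the optimal percentile vector of μ̃, i.e. ṽ_j = F_{μ̃}(ỹ_j) where {ỹ_1 < … < ỹ_k} is the support of a minimizer of ν ↦ W₁(μ̃,ν) over 𝒫_k(ℝ), and let ν_{Q_ṽ} be formed with respect to μ (i.e. with atoms at the μ-quantiles F_μ^{[-1]}(ṽ_j)). Then W₁(μ, ν_{Q_ṽ}) − inf_{ν ∈ 𝒫_k(ℝ)} W₁(μ,ν) ≤ W_∞(μ, μ̃) + 2·W₁(μ, μ̃) ≤ 3·W_∞(μ, μ̃); consequently the limit as n → ∞ of the Bayesian approximation ratio of PM_ṽ under μ differs from 1 by at most (W_∞(μ,μ̃) + 2W₁(μ,μ̃)) / (inf_{ν ∈ 𝒫_k(ℝ)} W₁(μ,ν)) ≤ 3·W_∞(μ,μ̃)/(inf_{ν ∈ 𝒫_k(ℝ)} W₁(μ,ν)). -/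

import Mathlib

open MeasureTheory Filter Topology ENNReal

/-- The 1-Wasserstein distance between two measures on ℝ, defined as the infimum of
transport costs over couplings. -/
noncomputable def W1 (α β : Measure ℝ) : ℝ :=
  sInf {c : ℝ | ∃ π : Measure (ℝ × ℝ), IsProbabilityMeasure π ∧
    π.map Prod.fst = α ∧ π.map Prod.snd = β ∧ c = ∫ p, |p.1 - p.2| ∂π}

/-- The ∞-Wasserstein distance between two measures on ℝ. -/
noncomputable def Winf (α β : Measure ℝ) : ℝ :=
  sInf {c : ℝ | ∃ π : Measure (ℝ × ℝ), IsProbabilityMeasure π ∧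
    π.map Prod.fst = α ∧ π.map Prod.snd = β ∧
    c = essSup (fun p : ℝ × ℝ => |p.1 - p.2|) π}

/-- `Pk k` : probability measures on ℝ supported on at most `k` points. -/
def Pk (k : ℕ) : Set (Measure ℝ) :=
  {ν | IsProbabilityMeasure ν ∧ ∃ s : Finset ℝ, s.card ≤ k ∧ ν ((↑s : Set ℝ)ᶜ) = 0}

/-- Wasserstein projection distance of `μ` onto `k`-point measures. -/
noncomputable def projDist (k : ℕ) (μ : Measure ℝ) : ℝ :=
  sInf {c : ℝ | ∃ ν ∈ Pk k, c = W1 μ ν}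

/-- Empirical measure of a tuple of points. -/
noncomputable def empMeas {n : ℕ} (x : Fin n → ℝ) : Measure ℝ :=
  ((n : ℝ≥0∞))⁻¹ • ∑ i : Fin n, Measure.dirac (x i)

/-- Social cost of facility placement `y` for agents at `x`. -/
noncomputable def SC {n k : ℕ} (x : Fin n → ℝ) (y : Fin k → ℝ) : ℝ :=
  (n : ℝ)⁻¹ * ∑ i : Fin n, ⨅ j : Fin k, |x i - y j|

/-- Optimal social cost for `k` facilities. -/
noncomputable def SCopt (k : ℕ) {n : ℕ} (x : Fin n → ℝ) : ℝ :=
  ⨅ y : Fin k → ℝ, SC x y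

/-- Topological support of a measure on ℝ. -/
def msupport (ν : Measure ℝ) : Set ℝ := {t : ℝ | ∀ U ∈ nhds t, ν U ≠ 0}

/-- Cumulative distribution function of a measure on ℝ. -/
noncomputable def mcdf (μ : Measure ℝ) (t : ℝ) : ℝ := (μ (Set.Iic t)).toReal

/-- Quantile (generalized inverse c.d.f.) of a measure on ℝ. -/
noncomputable def mquantile (μ : Measure ℝ) (v : ℝ) : ℝ := sInf {t : ℝ | v ≤ mcdf μ t}

/-- Basic assumptions: `μ` is an absolutely continuous probability measure with density `ρ`,
supported on a (closed) interval `S`, with `ρ` positive on the interior of `S`, vanishing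
outside `S`, and differentiable on `S`. -/
def BasicAssumptions (μ : Measure ℝ) : Prop :=
  IsProbabilityMeasure μ ∧
  ∃ (ρ : ℝ → ℝ) (S : Set ℝ),
    μ = volume.withDensity (fun x => ENNReal.ofReal (ρ x)) ∧
    IsClosed S ∧ S.OrdConnected ∧ μ Sᶜ = 0 ∧
    (∀ x ∈ interior S, 0 < ρ x) ∧ (∀ x ∉ S, ρ x = 0) ∧
    DifferentiableOn ℝ ρ S

/-- The percentile mechanism: facility `j` is placed at the `(⌊(n-1)vⱼ⌋+1)`-th smallest
coordinate of `x`. -/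
noncomputable def percentileMech {k : ℕ} (v : Fin k → ℝ) {n : ℕ} (x : Fin n → ℝ) :
    Fin k → ℝ :=
  fun j =>
    if h : 0 < n then
      x (Tuple.sort x ⟨min ⌊((n : ℝ) - 1) * v j⌋₊ (n - 1),
        Nat.lt_of_le_of_lt (min_le_right _ _) (by omega)⟩)
    else 0

/-- Social cost of the percentile mechanism with percentile vector `v`. -/
noncomputable def SCv {k : ℕ} (v : Fin k → ℝ) {n : ℕ} (x : Fin n → ℝ) : ℝ :=
  SC x (percentileMech v x)

/-- Cumulative masses of the Voronoi cells of the points `y 0 < y 1 < ⋯ < y (k-1)`: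
`cellBd μ y j = F_μ(z_j)` where `z_j = (y (j-1) + y j)/2` for `1 ≤ j ≤ k-1` (1-based),
with the conventions `F_μ(z_0) = 0` and `F_μ(z_k) = 1`. -/
noncomputable def cellBd (μ : Measure ℝ) {k : ℕ} (y : Fin k → ℝ) (j : ℕ) : ℝ :=
  if h0 : j = 0 then 0
  else if hk : k ≤ j then 1
  else mcdf μ ((y ⟨j - 1, by omega⟩ + y ⟨j, by omega⟩) / 2)

/-- The measure `ν_{Q_v}`: atoms at the quantiles `F_μ^{[-1]}(vⱼ)` weighted by the masses of
their Voronoi cells. -/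
noncomputable def nuQ (μ : Measure ℝ) {k : ℕ} (v : Fin k → ℝ) : Measure ℝ :=
  ∑ i : Fin k,
    ENNReal.ofReal (cellBd μ (fun j => mquantile μ (v j)) ((i : ℕ) + 1) -
        cellBd μ (fun j => mquantile μ (v j)) (i : ℕ)) •
      Measure.dirac (mquantile μ (v i))

/-! ### Distance to the nearest of finitely many points -/

/-- Distance from `x` to the nearest point of the tuple `y`. -/
noncomputable def nearestDist {k : ℕ} (y : Fin k → ℝ) (x : ℝ) : ℝ := ⨅ j : Fin k, |x - y j|

/-- Mean distance of a `μ`-random point to the tuple `y`. -/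
noncomputable def meanDist (μ : Measure ℝ) {k : ℕ} (y : Fin k → ℝ) : ℝ := ∫ x, nearestDist y x ∂μ

lemma nearestDist_le {k : ℕ} (y : Fin k → ℝ) (x : ℝ) (j : Fin k) :
    nearestDist y x ≤ |x - y j| :=
  ciInf_le (Set.finite_range _).bddBelow j

lemma nearestDist_nonneg {k : ℕ} (y : Fin k → ℝ) (x : ℝ) : 0 ≤ nearestDist y x :=
  Real.iInf_nonneg fun _ => abs_nonneg _

lemma exists_nearestDist_eq {k : ℕ} [NeZero k] (y : Fin k → ℝ) (x : ℝ) :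
    ∃ j, nearestDist y x = |x - y j| := by
  obtain ⟨j, hj⟩ := exists_eq_ciInf_of_finite (f := fun j : Fin k => |x - y j|)
  exact ⟨j, hj.symm⟩

lemma nearestDist_le_add {k : ℕ} [NeZero k] (y y' : Fin k → ℝ) (x x' : ℝ) :
    nearestDist y x ≤ nearestDist y' x' + |x - x'| + dist y y' := by
  obtain ⟨j, hj⟩ := exists_nearestDist_eq y' x'
  have h1 := nearestDist_le y x j
  have h2 := dist_le_pi_dist y y' j
  rw [Real.dist_eq, abs_sub_comm] at h2
  have h3 := abs_sub_le x x' (y j)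
  have h4 := abs_sub_le x' (y' j) (y j)
  linarith

lemma continuous_nearestDist {k : ℕ} [NeZero k] (y : Fin k → ℝ) :
    Continuous (nearestDist y) := by
  have : LipschitzWith 1 (nearestDist y) := LipschitzWith.of_le_add fun x x' => by
    simpa [Real.dist_eq] using nearestDist_le_add y y x x'
  exact this.continuous

/-- `α` is concentrated on a bounded set. -/
def BoundedAE (α : Measure ℝ) : Prop := ∃ R : ℝ, ∀ᵐ x ∂α, |x| ≤ R

lemma boundedAE_of_Icc {α : Measure ℝ} {a b : ℝ} (h : α (Set.Icc a b)ᶜ = 0) : BoundedAE α := by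
  refine ⟨max |a| |b|, ?_⟩
  have : ∀ᵐ x ∂α, x ∈ Set.Icc a b := h
  filter_upwards [this] with x hx
  exact abs_le_max_abs_abs hx.1 hx.2

lemma boundedAE_of_finset {α : Measure ℝ} {s : Finset ℝ} (h : α ((↑s : Set ℝ)ᶜ) = 0) :
    BoundedAE α := by
  obtain ⟨R, hR⟩ := (s.finite_toSet.isBounded).exists_norm_le
  refine ⟨R, ?_⟩
  have : ∀ᵐ x ∂α, x ∈ (s : Set ℝ) := h
  filter_upwards [this] with x hx
  exact hR x hx

lemma BoundedAE.memLp_nearestDist {α : Measure ℝ} [IsFiniteMeasure α] (h : BoundedAE α) {k : ℕ}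
    [NeZero k] (y : Fin k → ℝ) (p : ℝ≥0∞) : MemLp (nearestDist y) p α := by
  obtain ⟨R, hR⟩ := h
  refine MemLp.of_bound (continuous_nearestDist y).aestronglyMeasurable (R + |y 0|) ?_
  filter_upwards [hR] with x hx
  rw [Real.norm_eq_abs, abs_of_nonneg (nearestDist_nonneg y x)]
  have := nearestDist_le y x 0
  have h2 := abs_sub x (y 0)
  linarith

lemma BoundedAE.integrable_nearestDist {α : Measure ℝ} [IsFiniteMeasure α] (h : BoundedAE α)
    {k : ℕ} [NeZero k] (y : Fin k → ℝ) : Integrable (nearestDist y) α :=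
  memLp_one_iff_integrable.1 (h.memLp_nearestDist y 1)

lemma meanDist_le_add_dist {α : Measure ℝ} [IsProbabilityMeasure α] (h : BoundedAE α) {k : ℕ}
    [NeZero k] (y y' : Fin k → ℝ) : meanDist α y ≤ meanDist α y' + dist y y' := by
  have : ∫ x, (nearestDist y' x + dist y y') ∂α = meanDist α y' + dist y y' := by
    rw [integral_add (h.integrable_nearestDist y') (integrable_const _)]
    simp [meanDist]
  rw [← this]
  refine integral_mono (h.integrable_nearestDist y)
    ((h.integrable_nearestDist y').add (integrable_const _)) fun x => ?_
  simpa using nearestDist_le_add y y' x x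

/-! ### Couplings -/

/-- `π` is a probability measure with marginals `α` and `β`. -/
structure IsCoupling (π : Measure (ℝ × ℝ)) (α β : Measure ℝ) : Prop where
  prob : IsProbabilityMeasure π
  fst : π.map Prod.fst = α
  snd : π.map Prod.snd = β

lemma isCoupling_prod (α β : Measure ℝ) [IsProbabilityMeasure α] [IsProbabilityMeasure β] :
    IsCoupling (α.prod β) α β :=
  ⟨inferInstance, by simp, by simp⟩

lemma isCoupling_graph {α : Measure ℝ} [IsProbabilityMeasure α] {T : ℝ → ℝ} (hT : Measurable T) :
    IsCoupling (α.map fun x => (x, T x)) α (α.map T) := by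
  have hm : Measurable fun x : ℝ => (x, T x) := by fun_prop
  refine ⟨Measure.isProbabilityMeasure_map hm.aemeasurable, ?_, ?_⟩
  · rw [Measure.map_map measurable_fst hm]
    exact Measure.map_id
  · rw [Measure.map_map measurable_snd hm]
    rfl

namespace IsCoupling

variable {π : Measure (ℝ × ℝ)} {α β : Measure ℝ}

lemma ae_fst (h : IsCoupling π α β) {p : ℝ → Prop} (hp : ∀ᵐ x ∂α, p x) : ∀ᵐ z ∂π, p z.1 := by
  rw [← h.fst] at hp
  exact ae_of_ae_map measurable_fst.aemeasurable hp

lemma ae_snd (h : IsCoupling π α β) {p : ℝ → Prop} (hp : ∀ᵐ x ∂β, p x) : ∀ᵐ z ∂π, p z.2 := by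
  rw [← h.snd] at hp
  exact ae_of_ae_map measurable_snd.aemeasurable hp

lemma integrable_fst (h : IsCoupling π α β) {f : ℝ → ℝ} (hf : Integrable f α) :
    Integrable (fun z => f z.1) π := by
  rw [← h.fst] at hf
  exact hf.comp_measurable measurable_fst

lemma integrable_snd (h : IsCoupling π α β) {f : ℝ → ℝ} (hf : Integrable f β) :
    Integrable (fun z => f z.2) π := by
  rw [← h.snd] at hf
  exact hf.comp_measurable measurable_snd

lemma integral_fst (h : IsCoupling π α β) {f : ℝ → ℝ} (hf : AEStronglyMeasurable f α) :
    ∫ z, f z.1 ∂π = ∫ x, f x ∂α := by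
  rw [← h.fst] at hf ⊢
  rw [integral_map measurable_fst.aemeasurable hf]

lemma integral_snd (h : IsCoupling π α β) {f : ℝ → ℝ} (hf : AEStronglyMeasurable f β) :
    ∫ z, f z.2 ∂π = ∫ x, f x ∂β := by
  rw [← h.snd] at hf ⊢
  rw [integral_map measurable_snd.aemeasurable hf]

lemma integrable_dist (h : IsCoupling π α β) (hα : BoundedAE α) (hβ : BoundedAE β) :
    Integrable (fun z : ℝ × ℝ => |z.1 - z.2|) π := by
  have := h.prob
  obtain ⟨R, hR⟩ := hα
  obtain ⟨R', hR'⟩ := hβ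
  refine Integrable.of_bound (by fun_prop) (R + R') ?_
  filter_upwards [h.ae_fst hR, h.ae_snd hR'] with z h1 h2
  rw [Real.norm_eq_abs, abs_abs]
  have := abs_sub z.1 z.2
  linarith

lemma W1_le (h : IsCoupling π α β) : W1 α β ≤ ∫ z, |z.1 - z.2| ∂π := by
  refine csInf_le ⟨0, ?_⟩ ⟨π, h.prob, h.fst, h.snd, rfl⟩
  rintro _ ⟨π', -, -, -, rfl⟩
  exact integral_nonneg fun _ => abs_nonneg _

lemma ae_le_essSup (h : IsCoupling π α β) (hα : BoundedAE α) (hβ : BoundedAE β) :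
    ∀ᵐ z ∂π, |z.1 - z.2| ≤ essSup (fun p : ℝ × ℝ => |p.1 - p.2|) π := by
  obtain ⟨R, hR⟩ := hα
  obtain ⟨R', hR'⟩ := hβ
  refine _root_.ae_le_essSup ⟨R + R', ?_⟩
  rw [Filter.eventually_map]
  filter_upwards [h.ae_fst hR, h.ae_snd hR'] with z h1 h2
  have := abs_sub z.1 z.2
  linarith

end IsCoupling

lemma le_W1 {α β : Measure ℝ} [IsProbabilityMeasure α] [IsProbabilityMeasure β] {c : ℝ}
    (h : ∀ π, IsCoupling π α β → c ≤ ∫ z, |z.1 - z.2| ∂π) : c ≤ W1 α β := by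
  have hp := isCoupling_prod α β
  refine le_csInf ⟨_, _, hp.prob, hp.fst, hp.snd, rfl⟩ ?_
  rintro _ ⟨π, h1, h2, h3, rfl⟩
  exact h π ⟨h1, h2, h3⟩

lemma le_Winf {α β : Measure ℝ} [IsProbabilityMeasure α] [IsProbabilityMeasure β] {c : ℝ}
    (h : ∀ π, IsCoupling π α β → c ≤ essSup (fun p : ℝ × ℝ => |p.1 - p.2|) π) :
    c ≤ Winf α β := by
  have hp := isCoupling_prod α β
  refine le_csInf ⟨_, _, hp.prob, hp.fst, hp.snd, rfl⟩ ?_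
  rintro _ ⟨π, h1, h2, h3, rfl⟩
  exact h π ⟨h1, h2, h3⟩

lemma W1_nonneg (α β : Measure ℝ) : 0 ≤ W1 α β := by
  refine Real.sInf_nonneg ?_
  rintro _ ⟨π', -, -, -, rfl⟩
  exact integral_nonneg fun _ => abs_nonneg _

lemma W1_le_Winf {α β : Measure ℝ} [IsProbabilityMeasure α] [IsProbabilityMeasure β]
    (hα : BoundedAE α) (hβ : BoundedAE β) : W1 α β ≤ Winf α β := by
  refine le_Winf fun π h => h.W1_le.trans ?_
  have := h.prob
  calc ∫ z, |z.1 - z.2| ∂π ≤ ∫ _, essSup (fun p : ℝ × ℝ => |p.1 - p.2|) π ∂π :=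
        integral_mono_ae (h.integrable_dist hα hβ) (integrable_const _) (h.ae_le_essSup hα hβ)
    _ = _ := by simp

lemma meanDist_sub_meanDist_le_W1 {α β : Measure ℝ} [IsProbabilityMeasure α]
    [IsProbabilityMeasure β] (hα : BoundedAE α) (hβ : BoundedAE β) {k : ℕ} [NeZero k]
    (y : Fin k → ℝ) : |meanDist α y - meanDist β y| ≤ W1 α β := by
  refine le_W1 fun π h => ?_
  have hm := fun μ : Measure ℝ => (continuous_nearestDist y).aestronglyMeasurable (μ := μ)
  have i1 := h.integrable_fst (hα.integrable_nearestDist y)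
  have i2 := h.integrable_snd (hβ.integrable_nearestDist y)
  unfold meanDist
  rw [← h.integral_fst (hm α), ← h.integral_snd (hm β), ← integral_sub i1 i2]
  refine (abs_integral_le_integral_abs).trans ?_
  refine integral_mono (i1.sub i2).abs (h.integrable_dist hα hβ) fun z => ?_
  have h1 := nearestDist_le_add y y z.1 z.2
  have h2 := nearestDist_le_add y y z.2 z.1
  rw [abs_sub_comm z.2] at h2
  simp only [dist_self, add_zero] at h1 h2
  exact abs_le.2 ⟨by linarith, by linarith⟩

lemma meanDist_le_W1 {α β : Measure ℝ} [IsProbabilityMeasure α]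
    [IsProbabilityMeasure β] (hα : BoundedAE α) (hβ : BoundedAE β) {k : ℕ} [NeZero k]
    (y : Fin k → ℝ) (hy : ∀ᵐ x ∂β, x ∈ Set.range y) : meanDist α y ≤ W1 α β := by
  refine le_W1 fun π h => ?_
  unfold meanDist
  rw [← h.integral_fst (continuous_nearestDist y).aestronglyMeasurable]
  refine integral_mono_ae (h.integrable_fst (hα.integrable_nearestDist y))
    (h.integrable_dist hα hβ) ?_
  filter_upwards [h.ae_snd hy] with z ⟨j, hj⟩
  rw [← hj]
  exact nearestDist_le y z.1 j

lemma W1_map_le {α : Measure ℝ} [IsProbabilityMeasure α] {T : ℝ → ℝ} (hT : Measurable T) :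
    W1 α (α.map T) ≤ ∫ x, |x - T x| ∂α := by
  refine (isCoupling_graph hT).W1_le.trans_eq ?_
  rw [integral_map (by fun_prop) (by fun_prop)]

/-! ### Projection onto `k`-point measures -/

lemma projDist_le {μ ν : Measure ℝ} {k : ℕ} (h : ν ∈ Pk k) : projDist k μ ≤ W1 μ ν := by
  refine csInf_le ⟨0, ?_⟩ ⟨ν, h, rfl⟩
  rintro _ ⟨ν', -, rfl⟩
  exact W1_nonneg _ _

lemma map_mem_Pk {μ : Measure ℝ} [IsProbabilityMeasure μ] {T : ℝ → ℝ} (hT : Measurable T) {k : ℕ}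
    {s : Finset ℝ} (hs : s.card ≤ k) (h : ∀ᵐ x ∂μ, T x ∈ s) : μ.map T ∈ Pk k := by
  refine ⟨Measure.isProbabilityMeasure_map hT.aemeasurable, s, hs, ?_⟩
  rw [Measure.map_apply hT s.measurableSet.compl]
  exact h

lemma projDist_le_meanDist {μ : Measure ℝ} [IsProbabilityMeasure μ] {k : ℕ}
    [NeZero k] (y : Fin k → ℝ) : projDist k μ ≤ meanDist μ y := by
  classical
  let e : ℕ → ℝ := fun i => y (Fin.ofNat k i)
  let T := SimpleFunc.nearestPt e (k - 1)
  have hT : Measurable T := T.measurable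
  have hr : ∀ x, T x ∈ Finset.univ.image y := fun x => by
    simp only [T, SimpleFunc.nearestPt, SimpleFunc.map_apply, e]
    exact Finset.mem_image_of_mem _ (Finset.mem_univ _)
  have hc : (Finset.univ.image y).card ≤ k := Finset.card_image_le.trans (by simp)
  refine (projDist_le (map_mem_Pk hT hc (ae_of_all _ hr))).trans ((W1_map_le hT).trans_eq ?_)
  refine integral_congr_ae (ae_of_all _ fun x => ?_)
  apply le_antisymm
  · refine le_ciInf fun j => ?_
    have := SimpleFunc.edist_nearestPt_le e x (k := j) (N := k - 1) (by omega)
    rw [edist_dist, edist_dist, ENNReal.ofReal_le_ofReal_iff dist_nonneg] at this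
    simpa [T, e, Real.dist_eq, abs_sub_comm] using this
  · obtain ⟨j, -, hj⟩ := Finset.mem_image.1 (hr x)
    simp only [← hj]
    exact nearestDist_le y x j

lemma exists_tuple_of_finset {k : ℕ} {s : Finset ℝ} (hs : s.card ≤ k) (hne : s.Nonempty) :
    ∃ y : Fin k → ℝ, (s : Set ℝ) ⊆ Set.range y := by
  obtain ⟨x₀, hx₀⟩ := hne
  refine ⟨fun i => if h : (i : ℕ) < s.card then s.equivFin.symm ⟨i, h⟩ else x₀, fun x hx => ?_⟩
  refine ⟨⟨s.equivFin ⟨x, hx⟩, (s.equivFin ⟨x, hx⟩).2.trans_le hs⟩, ?_⟩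
  simp

lemma exists_meanDist_le_W1 {μ ν : Measure ℝ} [IsProbabilityMeasure μ] (hμ : BoundedAE μ) {k : ℕ}
    [NeZero k] (hν : ν ∈ Pk k) : ∃ y : Fin k → ℝ, meanDist μ y ≤ W1 μ ν := by
  obtain ⟨hp, s, hs, hs0⟩ := hν
  have hne : s.Nonempty := by
    rw [Finset.nonempty_iff_ne_empty]
    rintro rfl
    simp at hs0
  obtain ⟨y, hy⟩ := exists_tuple_of_finset hs hne
  refine ⟨y, meanDist_le_W1 hμ (boundedAE_of_finset hs0) y ?_⟩
  have : ∀ᵐ x ∂ν, x ∈ (s : Set ℝ) := hs0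
  filter_upwards [this] with x hx using hy hx

lemma exists_meanDist_lt {μ : Measure ℝ} [IsProbabilityMeasure μ] (hμ : BoundedAE μ) {k : ℕ}
    [NeZero k] {c : ℝ} (hc : projDist k μ < c) : ∃ y : Fin k → ℝ, meanDist μ y < c := by
  have hne : {c : ℝ | ∃ ν ∈ Pk k, c = W1 μ ν}.Nonempty :=
    ⟨_, Measure.dirac 0, ⟨inferInstance, {0}, by simpa using NeZero.one_le, by simp⟩, rfl⟩
  obtain ⟨_, ⟨ν, hν, rfl⟩, h⟩ := exists_lt_of_csInf_lt hne hc
  obtain ⟨y, hy⟩ := exists_meanDist_le_W1 hμ hν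
  exact ⟨y, hy.trans_lt h⟩

lemma projDist_le_add_W1 {α β : Measure ℝ} [IsProbabilityMeasure α] [IsProbabilityMeasure β]
    (hα : BoundedAE α) (hβ : BoundedAE β) {k : ℕ} [NeZero k] :
    projDist k β ≤ projDist k α + W1 α β := by
  refine le_of_forall_pos_lt_add fun ε hε => ?_
  obtain ⟨y, hy⟩ := exists_meanDist_lt hα (k := k) (lt_add_of_pos_right _ hε)
  have h1 := projDist_le_meanDist (μ := β) y
  have h2 := abs_le.1 (meanDist_sub_meanDist_le_W1 hα hβ y)
  linarith

/-! ### Atoms of an optimal `k`-point measure -/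

lemma notMem_msupport {ν : Measure ℝ} {s : Finset ℝ} (hs : ν ((↑s : Set ℝ)ᶜ) = 0) {t : ℝ}
    (ht : ν {t} = 0) : t ∉ msupport ν := by
  intro h
  refine h (((s : Set ℝ) \ {t})ᶜ) ?_ ?_
  · exact (s.finite_toSet.subset Set.sdiff_subset).isClosed.isOpen_compl.mem_nhds (by simp)
  · refine measure_mono_null (t := (↑s : Set ℝ)ᶜ ∪ {t}) ?_ (measure_union_null hs ht)
    intro x hx
    by_cases hxs : x ∈ (s : Set ℝ)
    · exact Or.inr (by_contra fun h => hx ⟨hxs, h⟩)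
    · exact Or.inl hxs

lemma measure_singleton_ne_zero_of_mem_msupport {ν : Measure ℝ} {k : ℕ} (hν : ν ∈ Pk k) {t : ℝ}
    (ht : t ∈ msupport ν) : ν {t} ≠ 0 := by
  obtain ⟨-, s, -, hs⟩ := hν
  exact fun h => notMem_msupport hs h ht

lemma ae_mem_msupport {ν : Measure ℝ} {k : ℕ} (hν : ν ∈ Pk k) : ∀ᵐ x ∂ν, x ∈ msupport ν := by
  obtain ⟨-, s, -, hs⟩ := hν
  have h2 : ν ((s : Set ℝ) \ msupport ν) = 0 := by
    rw [measure_null_iff_singleton (s.finite_toSet.subset Set.sdiff_subset).countable]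
    rintro x ⟨-, hx⟩
    simp only [msupport, Set.mem_ofPred_eq, not_forall, not_not] at hx
    obtain ⟨U, hU, h0⟩ := hx
    exact measure_mono_null (Set.singleton_subset_iff.2 (mem_of_mem_nhds hU)) h0
  have h1 : ∀ᵐ x ∂ν, x ∈ (s : Set ℝ) := hs
  have h3 : ∀ᵐ x ∂ν, x ∉ (s : Set ℝ) \ msupport ν := measure_eq_zero_iff_ae_notMem.1 h2
  filter_upwards [h1, h3] with x hx hx'
  exact by_contra fun h => hx' ⟨hx, h⟩

/-- Moving the atom of `ν` at `y` to a position that is closer, by the full displacement, to all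
points outside a set `B` of small mass strictly decreases the transport cost. -/
lemma projDist_lt_W1_of_shift {α ν : Measure ℝ} [IsProbabilityMeasure α] (hα : BoundedAE α)
    {k : ℕ} (hν : ν ∈ Pk k) {y y' : ℝ} (hne : y ≠ y') {B : Set ℝ} (hBm : MeasurableSet B)
    (hB : ∀ x ∉ B, |x - y'| ≤ |x - y| - |y - y'|) (hm : 2 * α.real B < ν.real {y}) :
    projDist k α < W1 α ν := by
  classical
  obtain ⟨hp, s, hs, hs0⟩ := id hν
  have hνb := boundedAE_of_finset hs0
  let T : ℝ → ℝ := fun x => if x = y then y' else x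
  have hT : Measurable T := Measurable.ite (measurableSet_singleton y) measurable_const measurable_id
  have hmem : ν.map T ∈ Pk k := by
    refine map_mem_Pk hT (s := s.image T) (Finset.card_image_le.trans hs) ?_
    have : ∀ᵐ x ∂ν, x ∈ (s : Set ℝ) := hs0
    filter_upwards [this] with x hx using Finset.mem_image_of_mem _ hx
  have hδ : 0 < |y - y'| := abs_pos.2 (sub_ne_zero.2 hne)
  have hgain : 0 < |y - y'| * (ν.real {y} - 2 * α.real B) := mul_pos hδ (by linarith)
  suffices projDist k α + |y - y'| * (ν.real {y} - 2 * α.real B) ≤ W1 α ν by linarith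
  refine le_W1 fun π h => ?_
  have := h.prob
  have hφ : Measurable fun z : ℝ × ℝ => (z.1, T z.2) := by fun_prop
  have h' : IsCoupling (π.map fun z => (z.1, T z.2)) α (ν.map T) := by
    refine ⟨Measure.isProbabilityMeasure_map hφ.aemeasurable, ?_, ?_⟩
    · rw [Measure.map_map measurable_fst hφ, ← h.fst]
      rfl
    · rw [Measure.map_map measurable_snd hφ, ← h.snd, Measure.map_map hT measurable_snd]
      rfl
  have hνTb : BoundedAE (ν.map T) := by
    obtain ⟨-, s', -, hs'⟩ := hmem
    exact boundedAE_of_finset hs'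
  have i0 := h.integrable_dist hα hνb
  have iB : Integrable (B.indicator fun _ => (1 : ℝ)) α := (integrable_const _).indicator hBm
  have iy : Integrable (({y} : Set ℝ).indicator fun _ => (1 : ℝ)) ν :=
    (integrable_const _).indicator (measurableSet_singleton y)
  have iB' := h.integrable_fst iB
  have iy' := h.integrable_snd iy
  have iT : Integrable (fun z : ℝ × ℝ => |z.1 - T z.2|) π :=
    (h'.integrable_dist hα hνTb).comp_measurable hφ
  have key : ∫ z, |z.1 - T z.2| ∂π ≤ ∫ z, (|z.1 - z.2| + |y - y'| *
      (2 * B.indicator (fun _ => (1 : ℝ)) z.1 - ({y} : Set ℝ).indicator (fun _ => (1 : ℝ)) z.2))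
      ∂π := by
    refine integral_mono iT (i0.add (((iB'.const_mul 2).sub iy').const_mul _)) fun z => ?_
    by_cases hz : z.2 = y <;> by_cases hzB : z.1 ∈ B
    · have := abs_sub_le z.1 y y'
      simp [T, hz, hzB]
      linarith
    · have := hB _ hzB
      simp [T, hz, hzB]
      linarith
    · simp [T, hz, hzB]
    · simp [T, hz, hzB]
  have iBy := ((iB'.const_mul 2).sub iy').const_mul |y - y'|
  simp only [Pi.sub_apply] at iBy
  rw [integral_add i0 iBy, integral_const_mul,
    integral_sub (iB'.const_mul 2) iy', integral_const_mul, h.integral_fst iB.1,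
    h.integral_snd iy.1, integral_indicator_const _ hBm,
    integral_indicator_const _ (measurableSet_singleton y)] at key
  have h2 := (projDist_le hmem).trans h'.W1_le
  rw [integral_map hφ.aemeasurable (by fun_prop)] at h2
  simp only [smul_eq_mul, mul_one] at key h2
  linarith

/-! ### Distribution functions and quantiles -/

lemma mcdf_eq_real (μ : Measure ℝ) (t : ℝ) : mcdf μ t = μ.real (Set.Iic t) := rfl

lemma mcdf_mono (μ : Measure ℝ) [IsFiniteMeasure μ] : Monotone (mcdf μ) := fun _ _ h =>
  measureReal_mono (Set.Iic_subset_Iic.2 h)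

lemma mcdf_le_one (μ : Measure ℝ) [IsProbabilityMeasure μ] (t : ℝ) : mcdf μ t ≤ 1 :=
  measureReal_le_one

lemma mcdf_eq_zero_of_lt {μ : Measure ℝ} {a b t : ℝ} (h : μ (Set.Icc a b)ᶜ = 0) (ht : t < a) :
    mcdf μ t = 0 := by
  have : μ (Set.Iic t) = 0 := measure_mono_null
    (show Set.Iic t ⊆ (Set.Icc a b)ᶜ from fun x hx hx' =>
      (hx'.1.trans (Set.mem_Iic.1 hx)).not_gt ht) h
  simp [mcdf, this]

lemma mcdf_eq_one_of_ae_le {μ : Measure ℝ} [IsProbabilityMeasure μ] {t : ℝ}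
    (h : ∀ᵐ x ∂μ, x ≤ t) : mcdf μ t = 1 := by
  have : μ (Set.Iic t) = 1 := (prob_compl_eq_zero_iff measurableSet_Iic).1 h
  simp [mcdf, this]

lemma exists_mcdf_lt {μ : Measure ℝ} [IsProbabilityMeasure μ] {t c : ℝ} (h : mcdf μ t < c) :
    ∃ δ > 0, mcdf μ (t + δ) < c := by
  have h1 : mcdf μ = ProbabilityTheory.cdf μ := by
    ext x
    rw [ProbabilityTheory.cdf_eq_real, mcdf_eq_real]
  have h2 : ContinuousWithinAt (mcdf μ) (Set.Ioi t) t := by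
    rw [h1]
    exact ((ProbabilityTheory.cdf μ).right_continuous t).mono Set.Ioi_subset_Ici_self
  have h3 := (h2.eventually (gt_mem_nhds h)).and self_mem_nhdsWithin
  obtain ⟨x, hx, hxt⟩ := h3.exists
  exact ⟨x - t, sub_pos.2 hxt, by simpa using hx⟩

section Quantile

variable {μ : Measure ℝ} {a b v w : ℝ}

lemma mquantile_set_nonempty [IsProbabilityMeasure μ] (h : μ (Set.Icc a b)ᶜ = 0) (hv1 : v ≤ 1) :
    {t : ℝ | v ≤ mcdf μ t}.Nonempty := by
  refine ⟨b, hv1.trans (mcdf_eq_one_of_ae_le ?_).ge⟩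
  have : ∀ᵐ x ∂μ, x ∈ Set.Icc a b := h
  filter_upwards [this] with x hx using hx.2

lemma mquantile_set_bddBelow (h : μ (Set.Icc a b)ᶜ = 0) (hv0 : 0 < v) :
    BddBelow {t : ℝ | v ≤ mcdf μ t} := by
  refine ⟨a, fun t ht => le_of_not_gt fun hlt => ?_⟩
  have := mcdf_eq_zero_of_lt h hlt
  simp only [Set.mem_ofPred_eq] at ht
  linarith

lemma le_mcdf_mquantile [IsProbabilityMeasure μ] (h : μ (Set.Icc a b)ᶜ = 0) (hv1 : v ≤ 1) :
    v ≤ mcdf μ (mquantile μ v) := by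
  by_contra! hlt
  obtain ⟨δ, hδ, hc⟩ := exists_mcdf_lt hlt
  obtain ⟨t, ht, ht'⟩ := exists_lt_of_csInf_lt (mquantile_set_nonempty h hv1)
    (show sInf {t : ℝ | v ≤ mcdf μ t} < mquantile μ v + δ by simpa [mquantile] using hδ)
  have := mcdf_mono μ ht'.le
  simp only [Set.mem_ofPred_eq] at ht
  linarith

lemma mquantile_le (h : μ (Set.Icc a b)ᶜ = 0) (hv0 : 0 < v) {t : ℝ} (ht : v ≤ mcdf μ t) :
    mquantile μ v ≤ t := csInf_le (mquantile_set_bddBelow h hv0) ht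

lemma mcdf_lt_of_lt_mquantile (h : μ (Set.Icc a b)ᶜ = 0) (hv0 : 0 < v) {t : ℝ}
    (ht : t < mquantile μ v) : mcdf μ t < v :=
  lt_of_not_ge fun hle => ht.not_ge (mquantile_le h hv0 hle)

lemma mquantile_mono [IsProbabilityMeasure μ] (h : μ (Set.Icc a b)ᶜ = 0) (hv0 : 0 < v)
    (hvw : v ≤ w) (hw1 : w ≤ 1) : mquantile μ v ≤ mquantile μ w :=
  mquantile_le h hv0 (hvw.trans (le_mcdf_mquantile h hw1))

end Quantile

/-! ### Consequences of the basic assumptions -/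

lemma BasicAssumptions.mcdf_eq_one_or_eq_zero {μ : Measure ℝ} (hμ : BasicAssumptions μ) {s t : ℝ}
    (hst : s < t) (h : mcdf μ s = mcdf μ t) : mcdf μ s = 1 ∨ mcdf μ t = 0 := by
  obtain ⟨hp, ρ, S, hρ, hSc, hSo, hS0, hpos, hout, hdiff⟩ := hμ
  have hac : μ ≪ volume := hρ ▸ withDensity_absolutelyContinuous _ _
  have hint : ∀ᵐ x ∂μ, x ∈ interior S := by
    have h1 : ∀ᵐ x ∂μ, x ∈ S := hS0
    have h2 : ∀ᵐ x ∂μ, x ∉ frontier S :=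
      measure_eq_zero_iff_ae_notMem.1 (hac (hSo.convex.addHaar_frontier volume))
    filter_upwards [h1, h2] with x hx hx'
    rw [hSc.frontier_eq] at hx'
    exact by_contra fun h => hx' ⟨hx, h⟩
  have hIoo : μ (Set.Ioo s t) = 0 := by
    have h1 : μ.real (Set.Iic t \ Set.Iic s) = 0 := by
      rw [measureReal_sdiff (Set.Iic_subset_Iic.2 hst.le) measurableSet_Iic]
      rw [mcdf_eq_real, mcdf_eq_real] at h
      linarith
    rw [measureReal_eq_zero_iff] at h1
    refine measure_mono_null (fun x hx => ?_) h1
    exact ⟨hx.2.le, not_le.2 hx.1⟩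
  have hdisj : Set.Ioo s t ∩ interior S = ∅ := by
    by_contra hne
    have hopen : IsOpen (Set.Ioo s t ∩ interior S) := isOpen_Ioo.inter isOpen_interior
    have hvol := hopen.measure_pos volume (Set.nonempty_iff_ne_empty.2 hne)
    have h0 : μ (Set.Ioo s t ∩ interior S) = 0 := measure_mono_null Set.inter_subset_left hIoo
    rw [hρ, withDensity_apply _ hopen.measurableSet] at h0
    have hcont : ContinuousOn (fun x => ENNReal.ofReal (ρ x)) (Set.Ioo s t ∩ interior S) :=
      ENNReal.continuous_ofReal.comp_continuousOn
        (hdiff.continuousOn.mono fun x hx => interior_subset hx.2)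
    rw [setLIntegral_eq_zero_iff' hopen.measurableSet
      (hcont.aemeasurable hopen.measurableSet)] at h0
    refine hvol.ne' (measure_eq_zero_iff_ae_notMem.2 ?_)
    filter_upwards [h0] with x hx hxU
    exact (hpos x hxU.2).not_ge (ENNReal.ofReal_eq_zero.1 (hx hxU))
  have hord : (interior S).OrdConnected := hSo.interior
  by_cases hcase : ∃ x ∈ interior S, x ≤ s
  · left
    obtain ⟨x, hx, hxs⟩ := hcase
    refine mcdf_eq_one_of_ae_le ?_
    filter_upwards [hint] with z hz
    by_contra! hzs
    have hsub := hord.out hx hz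
    have hmem : (s + min z t) / 2 ∈ Set.Ioo s t ∩ interior S := by
      have h1 : s < min z t := lt_min hzs hst
      have h2 := min_le_left z t
      have h3 := min_le_right z t
      exact ⟨⟨by linarith, by linarith⟩, hsub ⟨by linarith, by linarith⟩⟩
    simp [hdisj] at hmem
  · right
    push Not at hcase
    have : ∀ᵐ x ∂μ, x ∉ Set.Iic t := by
      have hnt : ∀ᵐ x ∂μ, x ∉ ({t} : Set ℝ) :=
        measure_eq_zero_iff_ae_notMem.1 (hac (measure_singleton t))
      filter_upwards [hint, hnt] with z hz hzt hz'
      have : z ∈ Set.Ioo s t ∩ interior S := ⟨⟨hcase z hz, lt_of_le_of_ne hz' hzt⟩, hz⟩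
      simp [hdisj] at this
    rw [mcdf, measure_eq_zero_iff_ae_notMem.2 this, ENNReal.toReal_zero]

lemma BasicAssumptions.exists_forall_measure_le {μ : Measure ℝ} (hμ : BasicAssumptions μ)
    {ε : ℝ≥0∞} (hε : ε ≠ 0) :
    ∃ δ > (0 : ℝ≥0∞), ∀ A : Set ℝ, MeasurableSet A → volume A < δ → μ A < ε := by
  obtain ⟨hp, ρ, S, hρ, -⟩ := hμ
  have hfin : ∫⁻ x, ENNReal.ofReal (ρ x) ≠ ∞ := by
    rw [← setLIntegral_univ, ← withDensity_apply _ MeasurableSet.univ, ← hρ]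
    simp
  obtain ⟨δ, hδ, h⟩ := exists_pos_setLIntegral_lt_of_measure_lt hfin hε
  refine ⟨δ, hδ, fun A hA hA' => ?_⟩
  rw [hρ, withDensity_apply _ hA]
  exact h A hA'

lemma BasicAssumptions.projDist_pos {μ : Measure ℝ} (hμ : BasicAssumptions μ) (hb : BoundedAE μ)
    {k : ℕ} [NeZero k] : 0 < projDist k μ := by
  have := hμ.1
  obtain ⟨δ, hδ, hδ'⟩ := hμ.exists_forall_measure_le (ε := ENNReal.ofReal (1 / 2)) (by simp)
  obtain ⟨r, hr, hrδ⟩ : ∃ r : ℝ, 0 < r ∧ (k : ℝ≥0∞) * ENNReal.ofReal (2 * r) < δ := by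
    have ht : Tendsto (fun r : ℝ => (k : ℝ≥0∞) * ENNReal.ofReal (2 * r)) (𝓝[>] 0) (𝓝 0) := by
      have h1 : Tendsto (fun r : ℝ => ENNReal.ofReal (2 * r)) (𝓝[>] 0) (𝓝 0) := by
        have : Continuous fun r : ℝ => ENNReal.ofReal (2 * r) :=
          ENNReal.continuous_ofReal.comp (by fun_prop)
        simpa using (this.tendsto 0).mono_left nhdsWithin_le_nhds
      simpa using ENNReal.Tendsto.const_mul h1 (Or.inr (ENNReal.natCast_ne_top k))
    obtain ⟨r, h1, h2⟩ := ((ht.eventually (gt_mem_nhds hδ)).and self_mem_nhdsWithin).exists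
    exact ⟨r, h2, h1⟩
  suffices ∀ y : Fin k → ℝ, r / 2 ≤ meanDist μ y by
    by_contra! hle
    obtain ⟨y, hy⟩ := exists_meanDist_lt hb (k := k) (hle.trans_lt (half_pos hr))
    linarith [this y]
  intro y
  let A : Set ℝ := ⋃ j, Metric.ball (y j) r
  have hA : MeasurableSet A := MeasurableSet.iUnion fun _ => measurableSet_ball
  have hμA : μ.real A ≤ 1 / 2 := by
    have h1 : volume A < δ := by
      refine lt_of_le_of_lt ((measure_iUnion_le _).trans_eq ?_) hrδ
      simp [Real.volume_ball]
    have h2 := (hδ' A hA h1).le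
    exact ENNReal.toReal_le_of_le_ofReal (by norm_num) h2
  have h3 : ∫ x, Aᶜ.indicator (fun _ => r) x ∂μ ≤ meanDist μ y := by
    refine integral_mono ((integrable_const r).indicator hA.compl) (hb.integrable_nearestDist y)
      fun x => ?_
    by_cases hx : x ∈ A
    · simpa [hx] using nearestDist_nonneg y x
    · obtain ⟨j, hj⟩ := exists_nearestDist_eq y x
      simp only [A, Set.mem_iUnion, Metric.mem_ball, not_exists, not_lt, Real.dist_eq] at hx
      have : x ∉ A := by simpa [A, Real.dist_eq] using hx
      simpa [this, hj] using hx j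
  rw [integral_indicator_const _ hA.compl, probReal_compl_eq_one_sub hA, smul_eq_mul] at h3
  nlinarith

/-! ### Quantiles at the levels of an optimal atom -/

section OptimalAtom

variable {α ν : Measure ℝ} [IsProbabilityMeasure α] {k : ℕ} {y : ℝ}

lemma mcdf_pos_of_optimal_atom (hα : BoundedAE α) (hν : ν ∈ Pk k) (hopt : W1 α ν = projDist k α)
    (hy : ν {y} ≠ 0) : 0 < mcdf α y := by
  by_contra! hle
  have := hν.1
  have hm : 0 < ν.real {y} := ENNReal.toReal_pos hy (measure_ne_top _ _)
  obtain ⟨δ, hδ, hlt⟩ := exists_mcdf_lt (hle.trans_lt (half_pos hm))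
  refine (projDist_lt_W1_of_shift hα hν (y := y) (y' := y + δ) (by linarith)
    (measurableSet_Iic (a := y + δ)) (fun x hx => ?_) ?_).ne' hopt
  · rw [Set.mem_Iic, not_le] at hx
    rw [abs_of_pos (by linarith), abs_of_pos (by linarith), abs_of_neg (by linarith)]
    linarith
  · rw [mcdf_eq_real] at hlt
    linarith

lemma mcdf_lt_one_of_lt_optimal_atom (hα : BoundedAE α) (hν : ν ∈ Pk k)
    (hopt : W1 α ν = projDist k α) (hy : ν {y} ≠ 0) {c : ℝ} (hc : c < y) : mcdf α c < 1 := by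
  refine lt_of_le_of_ne (mcdf_le_one α c) fun heq => ?_
  have := hν.1
  have hm : 0 < ν.real {y} := ENNReal.toReal_pos hy (measure_ne_top _ _)
  refine (projDist_lt_W1_of_shift hα hν (y := y) (y' := c) hc.ne'
    (measurableSet_Iic (a := c)).compl (fun x hx => ?_) ?_).ne' hopt
  · rw [Set.mem_compl_iff, not_not, Set.mem_Iic] at hx
    rw [abs_of_nonpos (by linarith), abs_of_neg (by linarith), abs_of_pos (by linarith)]
    linarith
  · rw [probReal_compl_eq_one_sub measurableSet_Iic, ← mcdf_eq_real, heq]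
    linarith

end OptimalAtom

lemma IsCoupling.mcdf_le {π : Measure (ℝ × ℝ)} {α β : Measure ℝ} (h : IsCoupling π α β) {w : ℝ}
    (hw : ∀ᵐ z ∂π, |z.1 - z.2| ≤ w) (t : ℝ) :
    mcdf α t ≤ mcdf β (t + w) ∧ mcdf β t ≤ mcdf α (t + w) := by
  have := h.prob
  have e1 : ∀ s, mcdf α s = π.real (Prod.fst ⁻¹' Set.Iic s) := fun s => by
    rw [mcdf_eq_real, ← h.fst, map_measureReal_apply measurable_fst measurableSet_Iic]
  have e2 : ∀ s, mcdf β s = π.real (Prod.snd ⁻¹' Set.Iic s) := fun s => by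
    rw [mcdf_eq_real, ← h.snd, map_measureReal_apply measurable_snd measurableSet_Iic]
  rw [e1, e1, e2, e2]
  constructor
  · refine ENNReal.toReal_mono (measure_ne_top _ _) (measure_mono_ae ?_)
    filter_upwards [hw] with z hz hz1
    have h1 : z.1 ≤ t := hz1
    have h2 := (abs_le.1 hz).1
    exact show z.2 ≤ t + w by linarith
  · refine ENNReal.toReal_mono (measure_ne_top _ _) (measure_mono_ae ?_)
    filter_upwards [hw] with z hz hz1
    have h1 : z.2 ≤ t := hz1
    have h2 := (abs_le.1 hz).2
    exact show z.1 ≤ t + w by linarith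

lemma BasicAssumptions.lt_mcdf_or_eq_one {μ : Measure ℝ} (hμ : BasicAssumptions μ) {a b v t : ℝ}
    (h : μ (Set.Icc a b)ᶜ = 0) (hv0 : 0 < v) (hv1 : v ≤ 1) (ht : mquantile μ v < t) :
    v < mcdf μ t ∨ v = 1 := by
  have := hμ.1
  by_contra! hcon
  have h1 := le_mcdf_mquantile h hv1
  have h2 := mcdf_mono μ ht.le
  rcases hμ.mcdf_eq_one_or_eq_zero ht (le_antisymm h2 (hcon.1.trans h1)) with h3 | h3
  · exact hcon.2 (le_antisymm hv1 (h3.symm.le.trans (h2.trans hcon.1)))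
  · linarith

lemma abs_mquantile_sub_le_Winf {μ μt : Measure ℝ} (hμ : BasicAssumptions μ)
    [IsProbabilityMeasure μt] {a b : ℝ} (hab : μ (Set.Icc a b)ᶜ = 0) (hμt : BoundedAE μt) {y : ℝ}
    (hpos : 0 < mcdf μt y) (hlt : ∀ c < y, mcdf μt c < 1) :
    |mquantile μ (mcdf μt y) - y| ≤ Winf μ μt := by
  have := hμ.1
  refine le_Winf fun π h => ?_
  have hw := h.ae_le_essSup (boundedAE_of_Icc hab) hμt
  set w := essSup (fun p : ℝ × ℝ => |p.1 - p.2|) π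
  have hF := h.mcdf_le hw
  have h1 := mcdf_le_one μt y
  refine abs_le.2 ⟨?_, by linarith [mquantile_le hab hpos (hF y).2]⟩
  by_contra! hq
  obtain ⟨t, ht, ht'⟩ := exists_between (show mquantile μ (mcdf μt y) < y - w by linarith)
  have hle : mcdf μ t ≤ mcdf μt y := (hF t).1.trans (mcdf_mono μt (by linarith))
  rcases hμ.lt_mcdf_or_eq_one hab hpos h1 ht with hlt' | heq
  · exact hlt'.not_ge hle
  · have h2 := le_mcdf_mquantile hab h1
    rw [heq] at h2 hq
    have h3 := (hF (mquantile μ 1)).1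
    have h4 := hlt (mquantile μ 1 + w) (by linarith)
    linarith

/-! ### Voronoi cells -/

/-- Union of the Voronoi cells of the first `j` points of the nondecreasing tuple `y`. -/
def voronoiUnion {k : ℕ} (y : Fin k → ℝ) (j : ℕ) : Set ℝ :=
  if h0 : j = 0 then ∅
  else if hk : k ≤ j then Set.univ
  else Set.Iic ((y ⟨j - 1, by omega⟩ + y ⟨j, by omega⟩) / 2)

lemma measurableSet_voronoiUnion {k : ℕ} (y : Fin k → ℝ) (j : ℕ) :
    MeasurableSet (voronoiUnion y j) := by
  unfold voronoiUnion
  split_ifs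
  exacts [MeasurableSet.empty, MeasurableSet.univ, measurableSet_Iic]

lemma measureReal_voronoiUnion (μ : Measure ℝ) [IsProbabilityMeasure μ] {k : ℕ} (y : Fin k → ℝ)
    (j : ℕ) : μ.real (voronoiUnion y j) = cellBd μ y j := by
  unfold voronoiUnion cellBd
  split_ifs <;> simp [mcdf_eq_real]

lemma voronoiUnion_mono {k : ℕ} {y : Fin k → ℝ} (hy : Monotone y) : Monotone (voronoiUnion y) := by
  intro i j hij
  unfold voronoiUnion
  by_cases hi : i = 0
  · simp [hi]
  have hj : j ≠ 0 := by omega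
  by_cases hjk : k ≤ j
  · simp [hj, hjk]
  have hik : ¬ k ≤ i := by omega
  simp only [hi, hj, hjk, hik, dite_false]
  refine Set.Iic_subset_Iic.2 ?_
  have h1 : y ⟨i - 1, by omega⟩ ≤ y ⟨j - 1, by omega⟩ := hy (Fin.mk_le_mk.2 (by omega))
  have h2 : y ⟨i, by omega⟩ ≤ y ⟨j, by omega⟩ := hy (Fin.mk_le_mk.2 hij)
  linarith

/-- The Voronoi cell of the `i`-th point of the nondecreasing tuple `y`. -/
def voronoiCell {k : ℕ} (y : Fin k → ℝ) (i : Fin k) : Set ℝ :=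
  voronoiUnion y (i + 1) \ voronoiUnion y i

lemma measurableSet_voronoiCell {k : ℕ} (y : Fin k → ℝ) (i : Fin k) :
    MeasurableSet (voronoiCell y i) :=
  (measurableSet_voronoiUnion y _).diff (measurableSet_voronoiUnion y _)

lemma measure_voronoiCell (μ : Measure ℝ) [IsProbabilityMeasure μ] {k : ℕ} {y : Fin k → ℝ}
    (hy : Monotone y) (i : Fin k) :
    μ (voronoiCell y i) = ENNReal.ofReal (cellBd μ y (i + 1) - cellBd μ y i) := by
  rw [← measureReal_voronoiUnion, ← measureReal_voronoiUnion,
    ← measureReal_sdiff (voronoiUnion_mono hy (Nat.le_succ _)) (measurableSet_voronoiUnion y _),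
    ofReal_measureReal]
  rfl

lemma disjoint_voronoiCell {k : ℕ} {y : Fin k → ℝ} (hy : Monotone y) :
    Pairwise (Function.onFun Disjoint (voronoiCell y)) := by
  have key : ∀ i j : Fin k, i < j → Disjoint (voronoiCell y i) (voronoiCell y j) := fun i j h =>
    Set.disjoint_left.2 fun _ hx hx' =>
      hx'.2 (voronoiUnion_mono hy (Nat.succ_le_of_lt h) hx.1)
  intro i j hij
  rcases lt_or_gt_of_ne hij with h | h
  · exact key i j h
  · exact (key j i h).symm

lemma iUnion_voronoiCell {k : ℕ} [NeZero k] (y : Fin k → ℝ) :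
    ⋃ i, voronoiCell y i = Set.univ := by
  classical
  refine Set.eq_univ_of_forall fun x => ?_
  have hk : x ∈ voronoiUnion y k := by simp [voronoiUnion, NeZero.ne k]
  have hex : ∃ j, x ∈ voronoiUnion y j := ⟨k, hk⟩
  have h1 := Nat.find_spec hex
  have h0 : Nat.find hex ≠ 0 := fun h => by
    rw [h] at h1
    simp [voronoiUnion] at h1
  have h2 : Nat.find hex ≤ k := Nat.find_le hk
  refine Set.mem_iUnion.2 ⟨⟨Nat.find hex - 1, by omega⟩, ?_, ?_⟩
  · rw [show Nat.find hex - 1 + 1 = Nat.find hex by omega]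
    exact h1
  · exact Nat.find_min hex (by simp only; omega)

lemma abs_sub_le_nearestDist_of_mem_voronoiCell {k : ℕ} [NeZero k] {y : Fin k → ℝ}
    (hy : Monotone y) {i : Fin k} {x : ℝ} (hx : x ∈ voronoiCell y i) :
    |x - y i| ≤ nearestDist y x := by
  obtain ⟨h1, h2⟩ := hx
  refine le_ciInf fun j => ?_
  rcases lt_trichotomy i j with hij | rfl | hij
  · have hk : ¬ k ≤ (i : ℕ) + 1 := by have := j.2; have : (i : ℕ) < j := hij; omega
    simp only [voronoiUnion, hk, dite_false, Nat.succ_ne_zero, Set.mem_Iic,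
      Nat.add_sub_cancel] at h1
    have h3 : y ⟨i + 1, by omega⟩ ≤ y j := hy (Fin.mk_le_of_le_val (Nat.succ_le_of_lt hij))
    have h4 : y i ≤ y j := hy hij.le
    rw [Fin.eta] at h1
    rcases abs_cases (x - y j) with h | h <;> rcases abs_cases (x - y i) with h' | h' <;> linarith
  · exact le_rfl
  · have hij' : (j : ℕ) < i := hij
    have hi0 : (i : ℕ) ≠ 0 := by omega
    have hk : ¬ k ≤ (i : ℕ) := by omega
    simp only [voronoiUnion, hk, dite_false, hi0, Set.mem_Iic, not_le] at h2
    have h3 : y j ≤ y ⟨i - 1, by omega⟩ := hy (Fin.le_def.2 (by simp only; omega))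
    have h4 : y j ≤ y i := hy hij.le
    rw [Fin.eta] at h2
    rcases abs_cases (x - y j) with h | h <;> rcases abs_cases (x - y i) with h' | h' <;> linarith

lemma W1_sum_cellBd_le_meanDist {μ : Measure ℝ} [IsProbabilityMeasure μ] (hμ : BoundedAE μ) {k : ℕ}
    [NeZero k] {y : Fin k → ℝ} (hy : Monotone y) :
    W1 μ (∑ i : Fin k, ENNReal.ofReal (cellBd μ y ((i : ℕ) + 1) - cellBd μ y (i : ℕ)) •
      Measure.dirac (y i)) ≤ meanDist μ y := by
  classical
  let T : ℝ → ℝ := fun x => ∑ i, (voronoiCell y i).indicator (fun _ => y i) x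
  have hT : Measurable T := Finset.measurable_sum _ fun i _ =>
    measurable_const.indicator (measurableSet_voronoiCell y i)
  have hTc : ∀ i, ∀ x ∈ voronoiCell y i, T x = y i := fun i x hx => by
    simp only [T]
    rw [Finset.sum_eq_single i]
    · simp [hx]
    · intro j _ hj
      exact Set.indicator_of_notMem (Set.disjoint_right.1 (disjoint_voronoiCell hy hj) hx) _
    · simp
  have hmap : ∑ i : Fin k, ENNReal.ofReal (cellBd μ y ((i : ℕ) + 1) - cellBd μ y (i : ℕ)) •
      Measure.dirac (y i) = μ.map T := by
    have hsum : μ = Measure.sum fun i => μ.restrict (voronoiCell y i) := by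
      rw [← Measure.restrict_iUnion (disjoint_voronoiCell hy) (measurableSet_voronoiCell y),
        iUnion_voronoiCell, Measure.restrict_univ]
    ext A hA
    rw [Measure.map_apply hT hA]
    conv_rhs => rw [hsum]
    rw [Measure.sum_apply _ (hT hA), tsum_fintype, Measure.finsetSum_apply]
    refine Finset.sum_congr rfl fun i _ => ?_
    rw [← measure_voronoiCell μ hy, Measure.restrict_apply (hT hA), Measure.smul_apply,
      Measure.dirac_apply' _ hA, smul_eq_mul]
    by_cases hi : y i ∈ A
    · have : T ⁻¹' A ∩ voronoiCell y i = voronoiCell y i :=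
        Set.inter_eq_right.2 fun x hx => by simpa [hTc i x hx] using hi
      simp [this, hi]
    · have : T ⁻¹' A ∩ voronoiCell y i = ∅ := by
        refine Set.eq_empty_of_forall_notMem fun x hx => hi ?_
        rw [← hTc i x hx.2]
        exact hx.1
      simp [this, hi]
  rw [hmap]
  refine (W1_map_le hT).trans ?_
  have hpt : ∀ x, |x - T x| ≤ nearestDist y x := fun x => by
    obtain ⟨i, hi⟩ := Set.mem_iUnion.1 ((iUnion_voronoiCell y).symm ▸ Set.mem_univ x)
    rw [hTc i x hi]
    exact abs_sub_le_nearestDist_of_mem_voronoiCell hy hi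
  refine integral_mono_of_nonneg (ae_of_all _ fun _ => abs_nonneg _) (hμ.integrable_nearestDist y)
    (ae_of_all _ hpt)

/-! ### Asymptotically negligible statistics of an i.i.d. sample -/

/-- The law of `n` independent samples from `μ`. -/
noncomputable abbrev sampleLaw (μ : Measure ℝ) (n : ℕ) : Measure (Fin n → ℝ) :=
  Measure.pi fun _ : Fin n => μ

/-- `H n` is eventually integrable under `n` independent samples from `μ`, with mean tending to
zero. -/
def MeanSmall (μ : Measure ℝ) (H : ∀ n : ℕ, (Fin n → ℝ) → ℝ) : Prop :=
  (∀ᶠ n in atTop, Integrable (H n) (sampleLaw μ n)) ∧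
    Tendsto (fun n => ∫ x, H n x ∂(sampleLaw μ n)) atTop (𝓝 0)

namespace MeanSmall

variable {μ : Measure ℝ} {H H' : ∀ n : ℕ, (Fin n → ℝ) → ℝ}

lemma zero : MeanSmall μ fun _ _ => 0 := ⟨by simp, by simp⟩

lemma add (h : MeanSmall μ H) (h' : MeanSmall μ H') :
    MeanSmall μ fun n x => H n x + H' n x := by
  refine ⟨h.1.and h'.1 |>.mono fun n hn => hn.1.add hn.2, ?_⟩
  have := h.2.add h'.2
  rw [add_zero] at this
  refine this.congr' ?_
  filter_upwards [h.1, h'.1] with n h1 h2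
  rw [integral_add h1 h2]

lemma const_mul (h : MeanSmall μ H) (c : ℝ) : MeanSmall μ fun n x => c * H n x := by
  refine ⟨h.1.mono fun n hn => hn.const_mul c, ?_⟩
  simpa [integral_const_mul] using h.2.const_mul c

lemma sum {ι : Type*} (s : Finset ι) {H : ι → ∀ n : ℕ, (Fin n → ℝ) → ℝ}
    (h : ∀ i ∈ s, MeanSmall μ (H i)) : MeanSmall μ fun n x => ∑ i ∈ s, H i n x := by
  classical
  induction s using Finset.induction_on with
  | empty => simpa using zero
  | insert i s hi ih =>
    simp only [Finset.sum_insert hi]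
    exact (h i (Finset.mem_insert_self i s)).add
      (ih fun j hj => h j (Finset.mem_insert_of_mem hj))

lemma of_abs_sub_le [IsProbabilityMeasure μ] {G : ∀ n : ℕ, (Fin n → ℝ) → ℝ} {c : ℝ}
    (hG : ∀ n, Measurable (G n))
    (h : ∀ ε > 0, ∃ H : ∀ n : ℕ, (Fin n → ℝ) → ℝ, MeanSmall μ H ∧
      ∀ᶠ n in atTop, ∀ᵐ x ∂(sampleLaw μ n), |G n x - c| ≤ ε + H n x) :
    MeanSmall μ fun n x => |G n x - c| := by
  have hint : ∀ ε > 0, ∀ H : ∀ n : ℕ, (Fin n → ℝ) → ℝ, MeanSmall μ H →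
      (∀ᶠ n in atTop, ∀ᵐ x ∂(sampleLaw μ n), |G n x - c| ≤ ε + H n x) →
      ∀ᶠ n in atTop, Integrable (fun x => |G n x - c|) (sampleLaw μ n) ∧
        ∫ x, |G n x - c| ∂(sampleLaw μ n) ≤ ε + ∫ x, H n x ∂(sampleLaw μ n) := by
    intro ε hε H hH hle
    filter_upwards [hH.1, hle] with n h1 h2
    have hi : Integrable (fun x => ε + H n x) (sampleLaw μ n) := (integrable_const ε).add h1
    have hi' : Integrable (fun x => |G n x - c|) (sampleLaw μ n) := by
      refine hi.mono' ((hG n).sub_const c).abs.aestronglyMeasurable ?_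
      filter_upwards [h2] with x hx
      rwa [Real.norm_eq_abs, abs_abs]
    refine ⟨hi', (integral_mono_ae hi' hi h2).trans_eq ?_⟩
    rw [integral_add (integrable_const ε) h1]
    simp
  constructor
  · obtain ⟨H, hH, hle⟩ := h 1 one_pos
    exact (hint 1 one_pos H hH hle).mono fun n hn => hn.1
  · refine tendsto_order.2 ⟨fun a ha => ?_, fun a ha => ?_⟩
    · exact Eventually.of_forall fun n => ha.trans_le (integral_nonneg fun _ => abs_nonneg _)
    · obtain ⟨H, hH, hle⟩ := h (a / 2) (half_pos ha)
      filter_upwards [hint _ (half_pos ha) H hH hle, hH.2.eventually (gt_mem_nhds (half_pos ha))]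
        with n h1 h2
      linarith [h1.2]

lemma tendsto_integral [IsProbabilityMeasure μ] {G : ∀ n : ℕ, (Fin n → ℝ) → ℝ} {c : ℝ}
    (hG : ∀ n, Measurable (G n)) (h : MeanSmall μ fun n x => |G n x - c|) :
    Tendsto (fun n => ∫ x, G n x ∂(sampleLaw μ n)) atTop (𝓝 c) := by
  rw [tendsto_iff_dist_tendsto_zero]
  refine tendsto_of_tendsto_of_tendsto_of_le_of_le' tendsto_const_nhds h.2
    (Eventually.of_forall fun _ => dist_nonneg) ?_
  filter_upwards [h.1] with n hn
  have h1 : Integrable (fun x => G n x - c) (sampleLaw μ n) :=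
    (integrable_norm_iff ((hG n).sub_const c).aestronglyMeasurable).1 hn
  have h2 : Integrable (G n) (sampleLaw μ n) := by
    refine (h1.add (integrable_const c)).congr (ae_of_all _ fun x => ?_)
    simp
  have h3 : ∫ x, (G n x - c) ∂(sampleLaw μ n) = ∫ x, G n x ∂(sampleLaw μ n) - c := by
    rw [integral_sub h2 (integrable_const c)]
    simp
  rw [Real.dist_eq, ← h3]
  exact abs_integral_le_integral_abs

end MeanSmall

lemma ae_sampleLaw {μ : Measure ℝ} [IsProbabilityMeasure μ] {p : ℝ → Prop} (hp : ∀ᵐ x ∂μ, p x)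
    (n : ℕ) : ∀ᵐ x ∂(sampleLaw μ n), ∀ i, p (x i) := by
  refine ae_all_iff.2 fun i => ?_
  exact (measurePreserving_eval (fun _ : Fin n => μ) i).quasiMeasurePreserving.ae hp

lemma integral_abs_le_sqrt {Ω : Type*} [MeasurableSpace Ω] {P : Measure Ω} [IsProbabilityMeasure P]
    {Z : Ω → ℝ} (hZ : MemLp Z 2 P) : ∫ ω, |Z ω| ∂P ≤ √(∫ ω, Z ω ^ 2 ∂P) := by
  refine Real.le_sqrt_of_sq_le ?_
  have h := ProbabilityTheory.variance_nonneg (fun ω => |Z ω|) P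
  have hZ' : MemLp (fun ω => |Z ω|) 2 P := hZ.abs
  rw [ProbabilityTheory.variance_eq_sub hZ'] at h
  simpa using h

/-- Weak law of large numbers in mean, for square-integrable statistics. -/
lemma meanSmall_abs_average_sub {μ : Measure ℝ} [IsProbabilityMeasure μ] {f : ℝ → ℝ}
    (hf : MemLp f 2 μ) :
    MeanSmall μ fun n x => |(n : ℝ)⁻¹ * ∑ i, f (x i) - ∫ t, f t ∂μ| := by
  have hmem : ∀ n (i : Fin n), MemLp (fun x : Fin n → ℝ => f (x i)) 2 (sampleLaw μ n) :=
    fun n i => hf.comp_measurePreserving (measurePreserving_eval (fun _ : Fin n => μ) i)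
  have havg : ∀ n, MemLp (fun x : Fin n → ℝ => (n : ℝ)⁻¹ * ∑ i, f (x i)) 2 (sampleLaw μ n) :=
    fun n => (memLp_finsetSum Finset.univ fun i _ => hmem n i).const_mul _
  have hdiff : ∀ n, MemLp (fun x : Fin n → ℝ => (n : ℝ)⁻¹ * ∑ i, f (x i) - ∫ t, f t ∂μ) 2
      (sampleLaw μ n) := fun n => (havg n).sub (memLp_const _)
  have hbound : ∀ n ≠ 0, ∫ x, |(n : ℝ)⁻¹ * ∑ i, f (x i) - ∫ t, f t ∂μ| ∂(sampleLaw μ n) ≤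
      √((n : ℝ)⁻¹ * ProbabilityTheory.variance f μ) := by
    intro n hn
    have hn' : (n : ℝ) ≠ 0 := Nat.cast_ne_zero.2 hn
    refine (integral_abs_le_sqrt (hdiff n)).trans (Real.sqrt_le_sqrt (le_of_eq ?_))
    have hmean : ∫ x, (n : ℝ)⁻¹ * ∑ i, f (x i) ∂(sampleLaw μ n) = ∫ t, f t ∂μ := by
      rw [integral_const_mul, integral_finsetSum _ fun i _ => (hmem n i).integrable (by norm_num)]
      have : ∀ i : Fin n, ∫ x : Fin n → ℝ, f (x i) ∂(sampleLaw μ n) = ∫ t, f t ∂μ := fun i => by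
        have hmp := measurePreserving_eval (fun _ : Fin n => μ) i
        have h := integral_map hmp.measurable.aemeasurable (f := f) (by rw [hmp.map_eq]; exact hf.1)
        rw [hmp.map_eq] at h
        exact h.symm
      simp [this, hn']
    have hvar := ProbabilityTheory.variance_eq_integral (havg n).aemeasurable
    rw [hmean] at hvar
    rw [← hvar, ProbabilityTheory.variance_const_mul]
    have hsum := ProbabilityTheory.variance_sum_pi (μ := fun _ : Fin n => μ) (X := fun _ => f)
      fun _ => hf
    have heq : (∑ i : Fin n, fun ω : Fin n → ℝ => f (ω i)) = fun ω => ∑ i, f (ω i) := by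
      ext; simp
    rw [heq] at hsum
    rw [hsum]
    simp
    field_simp
  refine ⟨Eventually.of_forall fun n => ((hdiff n).integrable (by norm_num)).abs, ?_⟩
  refine tendsto_of_tendsto_of_tendsto_of_le_of_le' tendsto_const_nhds
    (h := fun n : ℕ => √((n : ℝ)⁻¹ * ProbabilityTheory.variance f μ)) ?_
    (Eventually.of_forall fun _ => integral_nonneg fun _ => abs_nonneg _)
    ((eventually_ne_atTop 0).mono hbound)
  have h1 := (tendsto_inv_atTop_nhds_zero_nat (𝕜 := ℝ)).mul_const (ProbabilityTheory.variance f μ)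
  rw [zero_mul] at h1
  have h2 := (Real.continuous_sqrt.tendsto 0).comp h1
  rwa [Real.sqrt_zero] at h2

/-! ### Order statistics -/

lemma lt_card_iff_apply_sort_le {n : ℕ} (x : Fin n → ℝ) (t : ℝ) (m : Fin n) :
    (m : ℕ) < (Finset.univ.filter fun i => x i ≤ t).card ↔ x (Tuple.sort x m) ≤ t := by
  have h := Tuple.lt_card_le_iff_apply_le_of_monotone (f := x ∘ Tuple.sort x) (a := t) (j := m)
    (Tuple.monotone_sort x)
  have hc : (Finset.univ.filter fun i => (x ∘ Tuple.sort x) i ≤ t).card =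
      (Finset.univ.filter fun i => x i ≤ t).card := by
    refine Finset.card_bij (fun i _ => Tuple.sort x i) ?_ ?_ ?_
    · intro i hi
      simpa using hi
    · intro i _ j _ hij
      exact (Tuple.sort x).injective hij
    · intro i hi
      exact ⟨(Tuple.sort x).symm i, by simpa using hi, by simp⟩
  rw [hc] at h
  exact h

lemma card_filter_le_eq_sum {n : ℕ} (x : Fin n → ℝ) (t : ℝ) :
    ((Finset.univ.filter fun i => x i ≤ t).card : ℝ) =
      ∑ i, (Set.Iic t).indicator (fun _ => (1 : ℝ)) (x i) := by
  simp [Set.indicator_apply]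

lemma measurable_apply_sort {n : ℕ} (m : Fin n) :
    Measurable fun x : Fin n → ℝ => x (Tuple.sort x m) := by
  refine measurable_of_Iic fun t => ?_
  have : (fun x : Fin n → ℝ => x (Tuple.sort x m)) ⁻¹' Set.Iic t =
      {x | ((m : ℕ) : ℝ) < ∑ i, (Set.Iic t).indicator (fun _ => (1 : ℝ)) (x i)} := by
    ext x
    rw [Set.mem_preimage, Set.mem_Iic, ← lt_card_iff_apply_sort_le, Set.mem_ofPred_eq,
      ← card_filter_le_eq_sum, Nat.cast_lt]
  rw [this]
  refine measurableSet_lt measurable_const (Finset.measurable_sum _ fun i _ => ?_)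
  exact (measurable_const.indicator measurableSet_Iic).comp (measurable_pi_apply i)

lemma measurable_percentileMech {k : ℕ} (v : Fin k → ℝ) (n : ℕ) (j : Fin k) :
    Measurable fun x : Fin n → ℝ => percentileMech v x j := by
  unfold percentileMech
  split_ifs
  · exact measurable_apply_sort _
  · exact measurable_const

section Percentile

variable {k n : ℕ} {v : Fin k → ℝ} {j : Fin k} {x : Fin n → ℝ} {t : ℝ}

lemma average_indicator_le_of_lt_percentileMech (hn : 0 < n) (hv0 : 0 ≤ v j)
    (h : t < percentileMech v x j) :
    (n : ℝ)⁻¹ * ∑ i, (Set.Iic t).indicator (fun _ => (1 : ℝ)) (x i) ≤ v j := by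
  have hn' : (1 : ℝ) ≤ n := by exact_mod_cast hn
  simp only [percentileMech, hn, dite_true] at h
  rw [← not_le, ← lt_card_iff_apply_sort_le, not_lt] at h
  have h1 : ((Finset.univ.filter fun i => x i ≤ t).card : ℝ) ≤ ((n : ℝ) - 1) * v j := by
    have h2 := h.trans (min_le_left _ _)
    exact (Nat.cast_le.2 h2).trans (Nat.floor_le (mul_nonneg (by linarith) hv0))
  rw [card_filter_le_eq_sum] at h1
  rw [inv_mul_le_iff₀ (by linarith)]
  nlinarith

lemma lt_average_indicator_of_percentileMech_le (hn : 0 < n) (hv1 : v j ≤ 1)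
    (h : percentileMech v x j ≤ t) :
    v j - (n : ℝ)⁻¹ < (n : ℝ)⁻¹ * ∑ i, (Set.Iic t).indicator (fun _ => (1 : ℝ)) (x i) := by
  have hn' : (1 : ℝ) ≤ n := by exact_mod_cast hn
  simp only [percentileMech, hn, dite_true] at h
  rw [← lt_card_iff_apply_sort_le] at h
  have hfl : ⌊((n : ℝ) - 1) * v j⌋₊ ≤ n - 1 := by
    refine Nat.floor_le_of_le ?_
    rw [Nat.cast_sub hn, Nat.cast_one]
    nlinarith
  simp only [min_eq_left hfl] at h
  have h1 : ((n : ℝ) - 1) * v j < (Finset.univ.filter fun i => x i ≤ t).card :=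
    (Nat.lt_floor_add_one _).trans_le (by exact_mod_cast h)
  rw [card_filter_le_eq_sum] at h1
  rw [lt_inv_mul_iff₀ (by linarith), mul_sub, mul_inv_cancel₀ (by linarith)]
  nlinarith

lemma exists_percentileMech_eq (hn : 0 < n) (v : Fin k → ℝ) (j : Fin k) (x : Fin n → ℝ) :
    ∃ i, percentileMech v x j = x i := by
  simp only [percentileMech, hn, dite_true]
  exact ⟨_, rfl⟩

end Percentile

/-! ### Convergence of social costs -/

lemma meanSmall_ecdf (μ : Measure ℝ) [IsProbabilityMeasure μ] (t : ℝ) :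
    MeanSmall μ fun n x =>
      |(n : ℝ)⁻¹ * ∑ i, (Set.Iic t).indicator (fun _ => (1 : ℝ)) (x i) - mcdf μ t| := by
  have hint : ∫ s, (Set.Iic t).indicator (fun _ => (1 : ℝ)) s ∂μ = mcdf μ t := by
    rw [integral_indicator measurableSet_Iic]
    simp [mcdf_eq_real]
  rw [← hint]
  exact meanSmall_abs_average_sub ((memLp_const 1).indicator measurableSet_Iic)

/-- Sample percentiles converge in mean to quantiles. -/
lemma BasicAssumptions.meanSmall_percentileMech {μ : Measure ℝ} (hμ : BasicAssumptions μ) {a b : ℝ}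
    (hab : μ (Set.Icc a b)ᶜ = 0) {k : ℕ} {v : Fin k → ℝ} {j : Fin k} (hv0 : 0 < v j)
    (hv1 : v j ≤ 1) :
    MeanSmall μ fun _ x => |percentileMech v x j - mquantile μ (v j)| := by
  have := hμ.1
  obtain ⟨R, hR⟩ := boundedAE_of_Icc hab
  set q := mquantile μ (v j) with hq
  set K := |R| + |q|
  have hK : 0 ≤ K := by positivity
  have hdiff : ∀ n > 0, ∀ᵐ x ∂(sampleLaw μ n), |percentileMech v x j - q| ≤ K := by
    intro n hn
    filter_upwards [ae_sampleLaw hR n] with x hx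
    obtain ⟨i, hi⟩ := exists_percentileMech_eq hn v j x
    rw [hi]
    exact (abs_sub _ _).trans (add_le_add ((hx i).trans (le_abs_self R)) le_rfl)
  refine MeanSmall.of_abs_sub_le (fun n => measurable_percentileMech v n j) fun ε hε => ?_
  have hscale : ∀ {c d : ℝ}, 0 < c → c ≤ d → K ≤ K * c⁻¹ * d := by
    intro c d hc hcd
    have h1 : 1 ≤ c⁻¹ * d := by rwa [le_inv_mul_iff₀ hc, mul_one]
    rw [mul_assoc]
    exact le_mul_of_one_le_right hK h1
  have hupper : ∃ H : ∀ n : ℕ, (Fin n → ℝ) → ℝ, MeanSmall μ H ∧ (∀ n x, 0 ≤ H n x) ∧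
      ∀ᶠ n in atTop, ∀ᵐ x ∂(sampleLaw μ n), percentileMech v x j - q ≤ ε + H n x := by
    rcases hμ.lt_mcdf_or_eq_one hab hv0 hv1 (lt_add_of_pos_right q hε) with hlt | heq
    · have hc := sub_pos.2 hlt
      refine ⟨_, (meanSmall_ecdf μ (q + ε)).const_mul (K * (mcdf μ (q + ε) - v j)⁻¹),
        fun n x => by positivity, ?_⟩
      filter_upwards [eventually_gt_atTop 0] with n hn
      filter_upwards [hdiff n hn] with x hx
      rcases le_or_gt (percentileMech v x j) (q + ε) with hle | hgt
      · have : 0 ≤ K * (mcdf μ (q + ε) - v j)⁻¹ * |(n : ℝ)⁻¹ * ∑ i, (Set.Iic (q + ε)).indicator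
          (fun _ => (1 : ℝ)) (x i) - mcdf μ (q + ε)| := by positivity
        linarith
      · have h1 := average_indicator_le_of_lt_percentileMech hn hv0.le hgt
        have h2 := hscale hc (d := |(n : ℝ)⁻¹ * ∑ i, (Set.Iic (q + ε)).indicator
          (fun _ => (1 : ℝ)) (x i) - mcdf μ (q + ε)|) (by
            rw [abs_sub_comm]
            exact (sub_le_sub_left h1 _).trans (le_abs_self _))
        linarith [le_abs_self (percentileMech v x j - q)]
    · refine ⟨_, MeanSmall.zero, fun _ _ => le_rfl, ?_⟩
      have h1 : mcdf μ q = 1 :=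
        le_antisymm (mcdf_le_one μ q) (heq.ge.trans (le_mcdf_mquantile hab hv1))
      have h2 : ∀ᵐ x ∂μ, x ≤ q := by
        have h3 : μ (Set.Iic q) = 1 := (ENNReal.toReal_eq_one_iff _).1 h1
        exact (prob_compl_eq_zero_iff measurableSet_Iic).2 h3
      filter_upwards [eventually_gt_atTop 0] with n hn
      filter_upwards [ae_sampleLaw h2 n] with x hx
      obtain ⟨i, hi⟩ := exists_percentileMech_eq hn v j x
      rw [hi]
      linarith [hx i]
  have hlower : ∃ H : ∀ n : ℕ, (Fin n → ℝ) → ℝ, MeanSmall μ H ∧ (∀ n x, 0 ≤ H n x) ∧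
      ∀ᶠ n in atTop, ∀ᵐ x ∂(sampleLaw μ n), q - percentileMech v x j ≤ ε + H n x := by
    have hc : 0 < (v j - mcdf μ (q - ε)) / 2 :=
      half_pos (sub_pos.2 (mcdf_lt_of_lt_mquantile hab hv0 (sub_lt_self q hε)))
    refine ⟨_, (meanSmall_ecdf μ (q - ε)).const_mul (K * ((v j - mcdf μ (q - ε)) / 2)⁻¹),
      fun n x => by positivity, ?_⟩
    filter_upwards [eventually_gt_atTop 0,
      (tendsto_inv_atTop_nhds_zero_nat (𝕜 := ℝ)).eventually (gt_mem_nhds hc)] with n hn hn'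
    filter_upwards [hdiff n hn] with x hx
    rcases le_or_gt (percentileMech v x j) (q - ε) with hle | hgt
    · have h1 := lt_average_indicator_of_percentileMech_le hn hv1 hle
      have h2 := hscale hc (d := |(n : ℝ)⁻¹ * ∑ i, (Set.Iic (q - ε)).indicator
          (fun _ => (1 : ℝ)) (x i) - mcdf μ (q - ε)|) (le_trans (by linarith) (le_abs_self _))
      linarith [neg_le_abs (percentileMech v x j - q)]
    · have : 0 ≤ K * ((v j - mcdf μ (q - ε)) / 2)⁻¹ * |(n : ℝ)⁻¹ * ∑ i,
          (Set.Iic (q - ε)).indicator (fun _ => (1 : ℝ)) (x i) - mcdf μ (q - ε)| := by positivity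
      linarith
  obtain ⟨H, hH, hH0, hHle⟩ := hupper
  obtain ⟨H', hH', hH0', hHle'⟩ := hlower
  refine ⟨_, hH.add hH', ?_⟩
  filter_upwards [hHle, hHle'] with n h1 h2
  filter_upwards [h1, h2] with x hx hx'
  rw [abs_le]
  constructor <;> linarith [hH0 n x, hH0' n x]

section SocialCost

variable {n k : ℕ}

lemma SC_eq (x : Fin n → ℝ) (y : Fin k → ℝ) : SC x y = (n : ℝ)⁻¹ * ∑ i, nearestDist y (x i) := rfl

lemma SC_nonneg (x : Fin n → ℝ) (y : Fin k → ℝ) : 0 ≤ SC x y :=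
  mul_nonneg (by positivity) (Finset.sum_nonneg fun _ _ => nearestDist_nonneg _ _)

lemma SC_le_add [NeZero k] (x x' : Fin n → ℝ) (y y' : Fin k → ℝ) :
    SC x y ≤ SC x' y' + dist x x' + dist y y' := by
  rcases Nat.eq_zero_or_pos n with rfl | hn
  · simp only [SC_eq, Finset.univ_eq_empty, Finset.sum_empty, mul_zero]
    positivity
  have hn' : (0 : ℝ) < n := Nat.cast_pos.2 hn
  have h : ∑ i, nearestDist y (x i) ≤
      ∑ i, (nearestDist y' (x' i) + (dist x x' + dist y y')) := by
    refine Finset.sum_le_sum fun i _ => ?_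
    have h1 := nearestDist_le_add y y' (x i) (x' i)
    have h2 := dist_le_pi_dist x x' i
    rw [Real.dist_eq] at h2
    linarith
  rw [Finset.sum_add_distrib, Finset.sum_const, Finset.card_univ, Fintype.card_fin,
    nsmul_eq_mul] at h
  rw [SC_eq, SC_eq, inv_mul_le_iff₀ hn']
  refine h.trans_eq ?_
  field_simp
  ring

lemma SC_mono (x : Fin n → ℝ) {y y' : Fin k → ℝ}
    (h : ∀ i, nearestDist y (x i) ≤ nearestDist y' (x i)) : SC x y ≤ SC x y' :=
  mul_le_mul_of_nonneg_left (Finset.sum_le_sum fun i _ => h i) (by positivity)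

lemma SCopt_le (x : Fin n → ℝ) (y : Fin k → ℝ) : SCopt k x ≤ SC x y :=
  ciInf_le ⟨0, by rintro _ ⟨y', rfl⟩; exact SC_nonneg x y'⟩ y

lemma measurable_SCopt [NeZero k] : Measurable fun x : Fin n → ℝ => SCopt k x := by
  have : LipschitzWith 1 fun x : Fin n → ℝ => SCopt k x := LipschitzWith.of_le_add fun x x' => by
    rw [← sub_le_iff_le_add]
    refine le_ciInf fun y => ?_
    have h1 := SC_le_add x x' y y
    rw [dist_self] at h1
    linarith [SCopt_le x y]
  exact this.continuous.measurable

lemma measurable_SCv (v : Fin k → ℝ) : Measurable fun x : Fin n → ℝ => SCv v x := by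
  refine (Finset.measurable_sum _ fun i _ => Measurable.iInf fun j => ?_).const_mul _
  exact ((measurable_pi_apply i).sub (measurable_percentileMech v n j)).abs

lemma meanSmall_SC {μ : Measure ℝ} [IsProbabilityMeasure μ] (hμ : BoundedAE μ) [NeZero k]
    (y : Fin k → ℝ) : MeanSmall μ fun _ x => |SC x y - meanDist μ y| := by
  simp only [SC_eq, meanDist]
  exact meanSmall_abs_average_sub (hμ.memLp_nearestDist y 2)

end SocialCost

lemma BasicAssumptions.meanSmall_SCv {μ : Measure ℝ} (hμ : BasicAssumptions μ) {a b : ℝ}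
    (hab : μ (Set.Icc a b)ᶜ = 0) {k : ℕ} [NeZero k] {v : Fin k → ℝ} (hv0 : ∀ j, 0 < v j)
    (hv1 : ∀ j, v j ≤ 1) :
    MeanSmall μ fun _ x => |SCv v x - meanDist μ fun j => mquantile μ (v j)| := by
  have := hμ.1
  set q : Fin k → ℝ := fun j => mquantile μ (v j)
  refine MeanSmall.of_abs_sub_le (fun n => measurable_SCv v) fun ε hε => ⟨_,
    (MeanSmall.sum Finset.univ fun j _ => hμ.meanSmall_percentileMech hab (hv0 j) (hv1 j)).add
      (meanSmall_SC (boundedAE_of_Icc hab) q), ?_⟩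
  refine Eventually.of_forall fun n => ae_of_all _ fun x => ?_
  have hd : dist (percentileMech v x) q ≤ ∑ j, |percentileMech v x j - q j| := by
    refine (dist_pi_le_iff (Finset.sum_nonneg fun _ _ => abs_nonneg _)).2 fun j => ?_
    exact Finset.single_le_sum (f := fun j => |percentileMech v x j - q j|)
      (fun _ _ => abs_nonneg _) (Finset.mem_univ j)
  have h1 := SC_le_add x x (percentileMech v x) q
  have h2 := SC_le_add x x q (percentileMech v x)
  rw [dist_self, add_zero] at h1 h2
  rw [dist_comm q] at h2
  have h3 : |SCv v x - SC x q| ≤ dist (percentileMech v x) q := by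
    rw [abs_le, SCv]
    constructor <;> linarith
  have h4 := abs_sub_le (SCv v x) (SC x q) (meanDist μ q)
  linarith

lemma nearestDist_clamp_le {k : ℕ} [NeZero k] {a b x : ℝ} (hx : x ∈ Set.Icc a b) (y : Fin k → ℝ) :
    nearestDist (fun j => max a (min b (y j))) x ≤ nearestDist y x := by
  obtain ⟨j, hj⟩ := exists_nearestDist_eq y x
  refine (nearestDist_le _ x j).trans (hj ▸ ?_)
  have h1 := hx.1
  have h2 := hx.2
  simp only [max_def, min_def]
  split_ifs <;> rw [abs_le] <;> constructor <;>
    linarith [le_abs_self (x - y j), neg_abs_le (x - y j)]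

lemma meanSmall_SCopt {μ : Measure ℝ} [IsProbabilityMeasure μ] {a b : ℝ} (hle : a ≤ b)
    (hab : μ (Set.Icc a b)ᶜ = 0) (k : ℕ) [NeZero k] :
    MeanSmall μ fun _ x => |SCopt k x - projDist k μ| := by
  have hb := boundedAE_of_Icc hab
  refine MeanSmall.of_abs_sub_le (fun n => measurable_SCopt) fun ε hε => ?_
  obtain ⟨y₁, hy₁⟩ := exists_meanDist_lt hb (k := k) (lt_add_of_pos_right _ hε)
  obtain ⟨N, -, hNf, hN⟩ := (isCompact_Icc (a := fun _ : Fin k => a)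
    (b := fun _ => b)).finite_cover_balls hε
  refine ⟨_, (MeanSmall.sum hNf.toFinset fun y _ => meanSmall_SC hb y).add (meanSmall_SC hb y₁),
    Eventually.of_forall fun n => ?_⟩
  filter_upwards [ae_sampleLaw (show ∀ᵐ x ∂μ, x ∈ Set.Icc a b from hab) n] with x hx
  have hsum : 0 ≤ ∑ y ∈ hNf.toFinset, |SC x y - meanDist μ y| :=
    Finset.sum_nonneg fun _ _ => abs_nonneg _
  rw [abs_le]
  constructor
  · suffices projDist k μ - ε - ∑ y ∈ hNf.toFinset, |SC x y - meanDist μ y| ≤ SCopt k x by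
      linarith [abs_nonneg (SC x y₁ - meanDist μ y₁)]
    refine le_ciInf fun y => ?_
    have hmem : (fun j => max a (min b (y j))) ∈ Set.Icc (fun _ : Fin k => a) fun _ => b :=
      ⟨fun j => le_max_left _ _, fun j => max_le hle (min_le_left _ _)⟩
    obtain ⟨y₀, hy₀, hd⟩ := Set.mem_iUnion₂.1 (hN hmem)
    rw [Metric.mem_ball, dist_comm] at hd
    have h1 := SC_mono x fun i => nearestDist_clamp_le (hx i) y
    have h2 := SC_le_add x x y₀ fun j => max a (min b (y j))
    rw [dist_self, add_zero] at h2
    have h3 := projDist_le_meanDist (μ := μ) y₀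
    have h4 := Finset.single_le_sum (f := fun y => |SC x y - meanDist μ y|)
      (fun _ _ => abs_nonneg _) (hNf.mem_toFinset.2 hy₀)
    have h5 := neg_abs_le (SC x y₀ - meanDist μ y₀)
    linarith
  · linarith [SCopt_le x y₁, le_abs_self (SC x y₁ - meanDist μ y₁)]

/-- Stability of the optimal percentile mechanism: computing the optimal
percentile vector from an approximation `μ̃` of `μ` yields a limit Bayesian approximation
ratio within `(W_∞(μ,μ̃) + 2W₁(μ,μ̃)) / projDist ≤ 3·W_∞(μ,μ̃)/projDist` of `1`. -/
theorem stmt13 (μ μt : Measure ℝ) (hμ : BasicAssumptions μ) [IsProbabilityMeasure μt]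
    (a b : ℝ) (hab : a ≤ b)
    (hμsupp : μ ((Set.Icc a b)ᶜ) = 0) (hμtsupp : μt ((Set.Icc a b)ᶜ) = 0)
    {k : ℕ} (hk : 1 ≤ k)
    (νt : Measure ℝ) (hνt : νt ∈ Pk k) (hopt : W1 μt νt = projDist k μt)
    (yt : Fin k → ℝ) (hyt : StrictMono yt) (hsupp : msupport νt = Set.range yt) :
    W1 μ (nuQ μ (fun j => mcdf μt (yt j))) - projDist k μ ≤ Winf μ μt + 2 * W1 μ μt ∧
    Winf μ μt + 2 * W1 μ μt ≤ 3 * Winf μ μt ∧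
    ∃ L : ℝ,
      Tendsto (fun n : ℕ =>
          (∫ x : Fin n → ℝ, SCv (fun j => mcdf μt (yt j)) x
              ∂(Measure.pi fun _ : Fin n => μ)) /
            (∫ x : Fin n → ℝ, SCopt k x ∂(Measure.pi fun _ : Fin n => μ)))
        atTop (𝓝 L) ∧
      |L - 1| ≤ (Winf μ μt + 2 * W1 μ μt) / projDist k μ ∧
      |L - 1| ≤ 3 * Winf μ μt / projDist k μ := by
  have : NeZero k := ⟨by omega⟩
  have := hμ.1
  have := hνt.1
  have hbμ := boundedAE_of_Icc hμsupp
  have hbμt := boundedAE_of_Icc hμtsupp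
  have hbνt : BoundedAE νt := by
    obtain ⟨-, s, -, hs⟩ := hνt
    exact boundedAE_of_finset hs
  set q : Fin k → ℝ := fun j => mquantile μ (mcdf μt (yt j)) with hq
  have hatom : ∀ j, νt {yt j} ≠ 0 := fun j =>
    measure_singleton_ne_zero_of_mem_msupport hνt (hsupp ▸ Set.mem_range_self j)
  have hv0 : ∀ j, 0 < mcdf μt (yt j) := fun j =>
    mcdf_pos_of_optimal_atom hbμt hνt hopt (hatom j)
  have hv1 : ∀ j, mcdf μt (yt j) ≤ 1 := fun j => mcdf_le_one μt _
  have hqmono : Monotone q := fun i j hij =>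
    mquantile_mono hμsupp (hv0 i) (mcdf_mono μt (hyt.monotone hij)) (hv1 j)
  have hW : W1 μ μt ≤ Winf μ μt := W1_le_Winf hbμ hbμt
  have hdist : dist q yt ≤ Winf μ μt :=
    (dist_pi_le_iff ((W1_nonneg _ _).trans hW)).2 fun j =>
      abs_mquantile_sub_le_Winf hμ hμsupp hbμt (hv0 j) fun c hc =>
        mcdf_lt_one_of_lt_optimal_atom hbμt hνt hopt (hatom j) hc
  have hcost : meanDist μ q - projDist k μ ≤ Winf μ μt + 2 * W1 μ μt := by
    have h1 := meanDist_le_add_dist hbμ q yt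
    have h2 := abs_le.1 (meanDist_sub_meanDist_le_W1 hbμ hbμt yt)
    have h3 := meanDist_le_W1 hbμt hbνt yt (hsupp ▸ ae_mem_msupport hνt)
    have h4 := projDist_le_add_W1 hbμ hbμt (k := k)
    linarith [h2.2]
  have hbound : Winf μ μt + 2 * W1 μ μt ≤ 3 * Winf μ μt := by linarith
  have hP : 0 < projDist k μ := hμ.projDist_pos hbμ
  have hL : |meanDist μ q / projDist k μ - 1| ≤ (Winf μ μt + 2 * W1 μ μt) / projDist k μ := by
    rw [div_sub_one hP.ne', abs_of_nonneg
      (div_nonneg (sub_nonneg.2 (projDist_le_meanDist q)) hP.le)]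
    exact div_le_div_of_nonneg_right hcost hP.le
  refine ⟨?_, hbound, meanDist μ q / projDist k μ, ?_, hL,
    hL.trans (div_le_div_of_nonneg_right hbound hP.le)⟩
  · exact (sub_le_sub_right (W1_sum_cellBd_le_meanDist hbμ hqmono) _).trans hcost
  · exact (MeanSmall.tendsto_integral (fun _ => measurable_SCv _)
      (hμ.meanSmall_SCv hμsupp hv0 hv1)).div
        (MeanSmall.tendsto_integral (fun _ => measurable_SCopt)
          (meanSmall_SCopt hab hμsupp k)) hP.ne'
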